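/- Suppose p ≠ 2 and let l ∈ F_q^× be a non-square. Order the seven G-orbits on pairs of binary quadratic forms as O_1 = {(0,0)}, O_2 = orbit of (0,v^2), O_3 = orbit of (0,uv), O_4 = orbit of (0,u^2−lv^2), O_5 = orbit of (v^2,uv), O_6 = orbit of (v^2,u^2), O_7 = orbit of (uv,u^2+lv^2), with indicator functions e_i. Then for y ∈ O_i one has q^6 · \hat{e_j}(y) = m_{ij}, where the matrix (m_{ij}) has rows: row 1: [1, (q−1)(q+1)^2, (q−1)(q+1)^2 q/2, (q−1)^2 q(q+1)/2, (q+1)^2 q(q−1)^2, (q+1)^2 q^2 (q−1)^2/2, (q−1)^3 q^2 (q+1)/2]; row 2: [1, q^2−q−1, q(2q+1)(q−1)/2, −q(q−1)/2, (q^2−q−1)q(q−1), −q^2(q−1)(q+1)/2, −q^2(q−1)^2/2]; row 3: [1, (2q+1)(q−1), q(q^2−2q−1)/2, q(q−1)^2/2, −(q−1)(q+1)q, q^2(q−1)^2/2, −q^2(q−1)^2/2]; row 4: [1, −q−1, (q−1)(q+1)q/2, (q^2+1)q/2, −(q−1)(q+1)q, −q^2(q−1)(q+1)/2, q^2(q−1)(q+1)/2];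 row 5: [1, q^2−q−1, −(q+1)q/2, −q(q−1)/2, q, −q^2(q−1)/2, q^2(q−1)/2]; row 6: [1, −q−1, q(q−1)/2, −q(q−1)/2, −q(q−1), q^2, 0]; row 7: [1, −q−1, −(q+1)q/2, (q+1)q/2, (q+1)q, 0, −q^2]. -/

import Mathlib

open scoped Classical
open MvPolynomial Matrix

noncomputable section

/-- The standard additive character `t ↦ exp(2πi·Tr_{F/F_p}(t)/p)` of a finite field `F`
of characteristic `p`. -/
def psiF (p : ℕ) [Fact p.Prime] (F : Type*) [Field F] [Fintype F] [CharP F p] (t : F) : ℂ :=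
  letI : Algebra (ZMod p) F := ZMod.algebra F p
  Complex.exp (2 * Real.pi * Complex.I * ((Algebra.trace (ZMod p) F t).val : ℂ) / (p : ℂ))

variable {F : Type*} [Field F] [Fintype F]

/-- The binary quadratic form `a u² + b uv + c v²` attached to `(a,b,c)`. -/
def toPolyBQ (x : Fin 3 → F) : MvPolynomial (Fin 2) F :=
  C (x 0) * X 0 ^ 2 + C (x 1) * X 0 * X 1 + C (x 2) * X 1 ^ 2

/-- Substitution corresponding to the linear change of variables `(u,v) ↦ (u,v)·g`. -/
def subst2 (g : Matrix (Fin 2) (Fin 2) F) (P : MvPolynomial (Fin 2) F) : MvPolynomial (Fin 2) F :=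
  aeval (fun j => ∑ i : Fin 2, C (g i j) * X i) P

/-- The action of `GL₂(F) × GL₂(F)` on pairs of binary quadratic forms:
`(g₁,g₂)∘(A,B) = (α g₂Ag₂ᵀ + β g₂Bg₂ᵀ, γ g₂Ag₂ᵀ + δ g₂Bg₂ᵀ)` for `g₁ = [[α,β],[γ,δ]]`,
written at the level of the associated quadratic forms. -/
def pairActB (g₁ g₂ : Matrix.GeneralLinearGroup (Fin 2) F)
    (PQ : MvPolynomial (Fin 2) F × MvPolynomial (Fin 2) F) :
    MvPolynomial (Fin 2) F × MvPolynomial (Fin 2) F :=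
  (C ((g₁ : Matrix (Fin 2) (Fin 2) F) 0 0) * subst2 (g₂ : Matrix (Fin 2) (Fin 2) F) PQ.1 +
     C ((g₁ : Matrix (Fin 2) (Fin 2) F) 0 1) * subst2 (g₂ : Matrix (Fin 2) (Fin 2) F) PQ.2,
   C ((g₁ : Matrix (Fin 2) (Fin 2) F) 1 0) * subst2 (g₂ : Matrix (Fin 2) (Fin 2) F) PQ.1 +
     C ((g₁ : Matrix (Fin 2) (Fin 2) F) 1 1) * subst2 (g₂ : Matrix (Fin 2) (Fin 2) F) PQ.2)

/-- `x` lies in the `GL₂(F) × GL₂(F)`-orbit of `r` (pairs of binary quadratic forms). -/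
def InOrbitPB (r x : (Fin 3 → F) × (Fin 3 → F)) : Prop :=
  ∃ g₁ g₂ : Matrix.GeneralLinearGroup (Fin 2) F,
    pairActB g₁ g₂ (toPolyBQ r.1, toPolyBQ r.2) = (toPolyBQ x.1, toPolyBQ x.2)

/-- The bilinear form `[(A,B),(A',B')] = (aa' + bb'/2 + cc') + (dd' + ee'/2 + ff')`
on pairs of binary quadratic forms. -/
def bformPB (x y : (Fin 3 → F) × (Fin 3 → F)) : F :=
  (x.1 0 * y.1 0 + x.1 1 * y.1 1 / 2 + x.1 2 * y.1 2) +
    (x.2 0 * y.2 0 + x.2 1 * y.2 1 / 2 + x.2 2 * y.2 2)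

/-- The Fourier transform on the space of pairs of binary quadratic forms over `F`. -/
def FTPB (p : ℕ) [Fact p.Prime] [CharP F p] (Φ : (Fin 3 → F) × (Fin 3 → F) → ℂ)
    (y : (Fin 3 → F) × (Fin 3 → F)) : ℂ :=
  ((Fintype.card F : ℂ) ^ 6)⁻¹ * ∑ x : (Fin 3 → F) × (Fin 3 → F), Φ x * psiF p F (bformPB x y)

section Algebra

variable {K : Type*} [Field K]

/-- The coordinates of the form `A(au + cv, bu + dv)`, i.e. of `g A gᵀ` for `g = [[a, b], [c, d]]`. -/
def actForm (a b c d : K) (x : Fin 3 → K) : Fin 3 → K :=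
  ![x 0 * a ^ 2 + x 1 * (a * b) + x 2 * b ^ 2,
    2 * x 0 * (a * c) + x 1 * (a * d + b * c) + 2 * x 2 * (b * d),
    x 0 * c ^ 2 + x 1 * (c * d) + x 2 * d ^ 2]

/-- The discriminant of a binary quadratic form. -/
def discForm (x : Fin 3 → K) : K := x 1 ^ 2 - 4 * x 0 * x 2

/-- The pairing `aa' + bb'/2 + cc'` of binary quadratic forms. -/
def pairForm (x y : Fin 3 → K) : K := x 0 * y 0 + x 1 * y 1 / 2 + x 2 * y 2

/-- The cross product with respect to `pairForm`. -/
def crossForm (x y : Fin 3 → K) : Fin 3 → K :=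
  ![x 1 * y 2 - x 2 * y 1, 2 * (x 2 * y 0 - x 0 * y 2), x 0 * y 1 - x 1 * y 0]

theorem discForm_actForm (a b c d : K) (x : Fin 3 → K) :
    discForm (actForm a b c d x) = (a * d - b * c) ^ 2 * discForm x := by
  simp [discForm, actForm]; ring

theorem discForm_smul (k : K) (x : Fin 3 → K) : discForm (k • x) = k ^ 2 * discForm x := by
  simp [discForm]; ring

theorem pairForm_actForm (h2 : (2 : K) ≠ 0) (a b c d : K) (x y : Fin 3 → K) :
    pairForm x (actForm a b c d y) = pairForm (actForm a c b d x) y := by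
  simp [pairForm, actForm]; field_simp; ring

theorem pairForm_comm (x y : Fin 3 → K) : pairForm x y = pairForm y x := by
  simp only [pairForm]; ring

theorem pairForm_smul_left (k : K) (x y : Fin 3 → K) :
    pairForm (k • x) y = k * pairForm x y := by
  simp [pairForm]; ring

theorem pairForm_smul_right (k : K) (x y : Fin 3 → K) :
    pairForm x (k • y) = k * pairForm x y := by
  simp [pairForm]; ring

theorem pairForm_add_right (x y z : Fin 3 → K) :
    pairForm x (y + z) = pairForm x y + pairForm x z := by
  simp [pairForm]; ring

theorem actForm_adjugate (a b c d : K) (x : Fin 3 → K) :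
    actForm d (-b) (-c) a (actForm a b c d x) = (a * d - b * c) ^ 2 • x := by
  funext i; fin_cases i <;> simp [actForm] <;> ring

theorem actForm_smul (a b c d k : K) (x : Fin 3 → K) :
    actForm a b c d (k • x) = k • actForm a b c d x := by
  funext i; fin_cases i <;> simp [actForm] <;> ring

theorem actForm_zero (a b c d : K) : actForm a b c d 0 = 0 := by
  funext i; fin_cases i <;> simp [actForm]

theorem actForm_injective {a b c d : K} (h : a * d - b * c ≠ 0) :
    Function.Injective (actForm a b c d) := fun x y hxy => by
  have := congrArg (actForm d (-b) (-c) a) hxy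
  rw [actForm_adjugate, actForm_adjugate] at this
  exact smul_right_injective _ (pow_ne_zero 2 h) this

theorem actForm_eq_zero_iff {a b c d : K} (h : a * d - b * c ≠ 0) {x : Fin 3 → K} :
    actForm a b c d x = 0 ↔ x = 0 := by
  simpa only [actForm_zero] using (actForm_injective h).eq_iff (a := x) (b := 0)

theorem crossForm_actForm (a b c d : K) (x y : Fin 3 → K) :
    crossForm (actForm a b c d x) (actForm a b c d y) =
      (a * d - b * c) • actForm d (-c) (-b) a (crossForm x y) := by
  funext i; fin_cases i <;> simp [actForm, crossForm] <;> ring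

theorem crossForm_combination (α β γ δ : K) (x y : Fin 3 → K) :
    crossForm (α • x + β • y) (γ • x + δ • y) = (α * δ - β * γ) • crossForm x y := by
  funext i; fin_cases i <;> simp [crossForm] <;> ring

theorem crossForm_smul_smul (s t : K) (x : Fin 3 → K) : crossForm (s • x) (t • x) = 0 := by
  funext i; fin_cases i <;> (simp [crossForm]; ring_nf; try simp)

theorem pairForm_crossForm_left (h2 : (2 : K) ≠ 0) (x y : Fin 3 → K) :
    pairForm (crossForm x y) x = 0 := by
  simp [pairForm, crossForm]; field_simp; ring

theorem pairForm_crossForm_right (h2 : (2 : K) ≠ 0) (x y : Fin 3 → K) :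
    pairForm (crossForm x y) y = 0 := by
  simp [pairForm, crossForm]; field_simp; ring

theorem funext_three {α : Type*} {x y : Fin 3 → α} (h0 : x 0 = y 0) (h1 : x 1 = y 1) (h2 : x 2 = y 2) :
    x = y := by
  funext i; fin_cases i <;> assumption

/-- Two forms with vanishing cross product are proportional. -/
theorem exists_smul_of_crossForm_eq_zero (h2 : (2 : K) ≠ 0) {x y : Fin 3 → K} (hx : x ≠ 0)
    (h : crossForm x y = 0) : ∃ t : K, y = t • x := by
  have e0 : x 1 * y 2 - x 2 * y 1 = 0 := by simpa [crossForm] using congrFun h 0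
  have e1 : x 2 * y 0 - x 0 * y 2 = 0 := by simpa [crossForm, h2] using congrFun h 1
  have e2 : x 0 * y 1 - x 1 * y 0 = 0 := by simpa [crossForm] using congrFun h 2
  by_cases a0 : x 0 = 0
  · by_cases a1 : x 1 = 0
    · have a2 : x 2 ≠ 0 := fun a2 => hx (funext_three a0 a1 a2)
      refine ⟨y 2 / x 2, funext_three ?_ ?_ ?_⟩ <;> simp <;> field_simp
      · linear_combination e1
      · linear_combination -e0
    · refine ⟨y 1 / x 1, funext_three ?_ ?_ ?_⟩ <;> simp <;> field_simp
      · linear_combination -e2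
      · linear_combination e0
  · refine ⟨y 0 / x 0, funext_three ?_ ?_ ?_⟩ <;> simp <;> field_simp
    · linear_combination e2
    · linear_combination -e1

/-- A form orthogonal to two independent forms is proportional to their cross product. -/
theorem exists_smul_crossForm (h2 : (2 : K) ≠ 0) {x y z : Fin 3 → K} (h : crossForm x y ≠ 0)
    (hx : pairForm z x = 0) (hy : pairForm z y = 0) : ∃ t : K, z = t • crossForm x y := by
  refine exists_smul_of_crossForm_eq_zero h2 h ?_
  simp only [pairForm] at hx hy
  have hinv : (2 : K) * 2⁻¹ = 1 := mul_inv_cancel₀ h2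
  refine funext_three ?_ ?_ ?_ <;> simp [crossForm]
  · linear_combination 2 * y 0 * hx - 2 * x 0 * hy - (y 0 * x 1 - x 0 * y 1) * z 1 * hinv
  · right
    linear_combination y 1 * hx - x 1 * hy
  · linear_combination 2 * y 2 * hx - 2 * x 2 * hy - (x 1 * y 2 - x 2 * y 1) * z 1 * hinv

/-- A form orthogonal to the cross product of two independent forms lies in their span. -/
theorem exists_combination_of_pairForm_crossForm (h2 : (2 : K) ≠ 0) {x y z : Fin 3 → K}
    (h : crossForm x y ≠ 0) (hz : pairForm (crossForm x y) z = 0) :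
    ∃ s t : K, z = s • x + t • y := by
  have e : (x 1 * y 2 - x 2 * y 1) * z 0 + (x 2 * y 0 - x 0 * y 2) * z 1 +
      (x 0 * y 1 - x 1 * y 0) * z 2 = 0 := by
    simp [pairForm, crossForm] at hz
    field_simp at hz
    linear_combination hz
  have key : ∀ n s t : K, n ≠ 0 → n • z = s • x + t • y → ∃ s t : K, z = s • x + t • y :=
    fun n s t hn hz => ⟨n⁻¹ * s, n⁻¹ * t, by
      rw [mul_smul, mul_smul, ← smul_add, ← hz, inv_smul_smul₀ hn]⟩
  by_cases n0 : x 1 * y 2 - x 2 * y 1 = 0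
  · by_cases n1 : x 2 * y 0 - x 0 * y 2 = 0
    · have n2 : x 0 * y 1 - x 1 * y 0 ≠ 0 := fun n2 =>
        h (funext_three (by simpa [crossForm]) (by simp [crossForm, n1]) (by simpa [crossForm]))
      refine key _ (z 0 * y 1 - z 1 * y 0) (x 0 * z 1 - x 1 * z 0) n2 (funext_three ?_ ?_ ?_) <;>
        simp
      · ring
      · ring
      · linear_combination e
    · refine key _ (z 2 * y 0 - z 0 * y 2) (x 2 * z 0 - x 0 * z 2) n1 (funext_three ?_ ?_ ?_) <;>
        simp
      · ring
      · linear_combination e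
      · ring
  · refine key _ (z 1 * y 2 - z 2 * y 1) (x 1 * z 2 - x 2 * z 1) n0 (funext_three ?_ ?_ ?_) <;>
      simp
    · linear_combination e
    · ring
    · ring

theorem ringChar_ne_two (h2 : (2 : K) ≠ 0) : ringChar K ≠ 2 := fun h => h2 <| by
  have := ringChar.Nat.cast_ringChar (R := K)
  rwa [h, Nat.cast_ofNat] at this

end Algebra

section Classification

variable {K : Type*} [Field K]

/-- The type of a nonzero binary quadratic form: `0` for a multiple of a square of a linear form,
`1` for a product of two independent linear forms, `2` for an irreducible form. -/
def formType (x : Fin 3 → K) : Fin 3 :=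
  if discForm x = 0 then 0 else if IsSquare (discForm x) then 1 else 2

/-- The standard forms `v²`, `uv`, `u² - lv²`. -/
def stdForm (l : K) : Fin 3 → Fin 3 → K := ![![0, 0, 1], ![0, 1, 0], ![1, 0, -l]]

theorem isSquare_sq_mul_iff {k d : K} (hk : k ≠ 0) : IsSquare (k ^ 2 * d) ↔ IsSquare d := by
  constructor
  · rintro ⟨m, hm⟩
    refine ⟨m / k, ?_⟩
    field_simp
    linear_combination hm
  · rintro ⟨m, rfl⟩
    exact ⟨k * m, by ring⟩

theorem formType_eq_of_discForm_eq {k : K} (hk : k ≠ 0) {x y : Fin 3 → K}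
    (h : discForm y = k ^ 2 * discForm x) : formType y = formType x := by
  simp only [formType, h, isSquare_sq_mul_iff hk, mul_eq_zero, pow_eq_zero_iff two_ne_zero, hk,
    false_or]

theorem formType_smul {k : K} (hk : k ≠ 0) (x : Fin 3 → K) : formType (k • x) = formType x :=
  formType_eq_of_discForm_eq hk (discForm_smul k x)

theorem formType_actForm {a b c d : K} (h : a * d - b * c ≠ 0) (x : Fin 3 → K) :
    formType (actForm a b c d x) = formType x :=
  formType_eq_of_discForm_eq h (discForm_actForm a b c d x)

/-- The indicator function of the nonzero forms of type `t`. -/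
def typeInd (t : Fin 3) (x : Fin 3 → K) : ℂ := if x ≠ 0 ∧ formType x = t then 1 else 0

theorem typeInd_smul {k : K} (hk : k ≠ 0) (t : Fin 3) (x : Fin 3 → K) :
    typeInd t (k • x) = typeInd t x := by
  simp [typeInd, formType_smul hk, hk]

theorem typeInd_actForm {a b c d : K} (h : a * d - b * c ≠ 0) (t : Fin 3) (x : Fin 3 → K) :
    typeInd t (actForm a b c d x) = typeInd t x := by
  simp [typeInd, formType_actForm h, actForm_eq_zero_iff h]

theorem formType_stdForm (h2 : (2 : K) ≠ 0) {l : K} (hl : ¬ IsSquare l) (t : Fin 3) :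
    formType (stdForm l t) = t := by
  have hl0 : l ≠ 0 := fun h => hl (h ▸ IsSquare.zero)
  have h4 : (4 : K) * l = 2 ^ 2 * l := by ring
  fin_cases t
  · simp [formType, discForm, stdForm]
  · simp [formType, discForm, stdForm]
  · simp [formType, discForm, stdForm, hl0, h4, h2, isSquare_sq_mul_iff, hl]

theorem stdForm_ne_zero (l : K) (t : Fin 3) : stdForm l t ≠ 0 := by
  intro h
  fin_cases t
  · simpa [stdForm] using congrFun h 2
  · simpa [stdForm] using congrFun h 1
  · simpa [stdForm] using congrFun h 0

theorem exists_eq_mul_sq_of_not_isSquare [Fintype K] {l d : K} (hl : ¬ IsSquare l)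
    (hd : ¬ IsSquare d) : ∃ m, d = l * m ^ 2 := by
  have hl0 : l ≠ 0 := fun h => hl (h ▸ IsSquare.zero)
  have hd0 : d ≠ 0 := fun h => hd (h ▸ IsSquare.zero)
  have h : quadraticChar K (d * l) = 1 := by
    rw [map_mul, quadraticChar_neg_one_iff_not_isSquare.2 hl,
      quadraticChar_neg_one_iff_not_isSquare.2 hd]; rfl
  obtain ⟨n, hn⟩ := (quadraticChar_one_iff_isSquare (mul_ne_zero hd0 hl0)).1 h
  refine ⟨n / l, ?_⟩
  field_simp
  linear_combination hn

/-- Every nonzero form is, up to a scalar, equivalent to the standard form of its type. -/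
theorem exists_smul_actForm_stdForm [Fintype K] (h2 : (2 : K) ≠ 0) {l : K} (hl : ¬ IsSquare l)
    {x : Fin 3 → K} (hx : x ≠ 0) : ∃ k a b c d : K, k ≠ 0 ∧ a * d - b * c ≠ 0 ∧
      x = k • actForm a b c d (stdForm l (formType x)) := by
  by_cases hD : discForm x = 0
  · have ht : formType x = 0 := by simp [formType, hD]
    simp only [discForm] at hD
    rw [ht]
    by_cases x0 : x 0 = 0
    · have x1 : x 1 = 0 := by simpa [x0] using hD
      have x2 : x 2 ≠ 0 := fun x2 => hx (funext_three x0 x1 x2)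
      refine ⟨x 2, 1, 0, 0, 1, x2, by simp, funext_three ?_ ?_ ?_⟩ <;>
        simp [actForm, stdForm, x0, x1]
    · refine ⟨x 0, 0, 1, 1, x 1 / (2 * x 0), x0, by simp, funext_three ?_ ?_ ?_⟩ <;>
        simp [actForm, stdForm] <;> field_simp
      linear_combination -hD
  by_cases hS : IsSquare (discForm x)
  · have ht : formType x = 1 := by simp [formType, hD, hS]
    obtain ⟨m, hm⟩ := hS
    have m0 : m ≠ 0 := by rintro rfl; exact hD (by simpa using hm)
    simp only [discForm] at hm
    rw [ht]
    by_cases x0 : x 0 = 0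
    · have x1 : x 1 ≠ 0 := fun x1 => m0 (by simpa [x0, x1, eq_comm] using hm)
      refine ⟨1, 0, x 1, 1, x 2, one_ne_zero, by simpa, funext_three ?_ ?_ ?_⟩ <;>
        simp [actForm, stdForm, x0]
    · refine ⟨x 0, 1, 1, (x 1 + m) / (2 * x 0), (x 1 - m) / (2 * x 0), x0, ?_,
        funext_three ?_ ?_ ?_⟩
      · have : 1 * ((x 1 - m) / (2 * x 0)) - 1 * ((x 1 + m) / (2 * x 0)) = -m / x 0 := by
          field_simp; ring
        rw [this]
        exact div_ne_zero (neg_ne_zero.2 m0) x0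
      · simp [actForm, stdForm]
      · simp [actForm, stdForm]; field_simp; ring
      · simp [actForm, stdForm]; field_simp; linear_combination -hm
  · have ht : formType x = 2 := by simp [formType, hD, hS]
    obtain ⟨m, hm⟩ := exists_eq_mul_sq_of_not_isSquare hl hS
    have m0 : m ≠ 0 := by rintro rfl; exact hD (by simpa using hm)
    have x0 : x 0 ≠ 0 := fun x0 => hS ⟨x 1, by simp [discForm, x0, sq]⟩
    simp only [discForm] at hm
    rw [ht]
    refine ⟨x 0, 1, 0, x 1 / (2 * x 0), m / (2 * x 0), x0, ?_, funext_three ?_ ?_ ?_⟩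
    · simp [m0, x0, h2]
    · simp [actForm, stdForm]
    · simp [actForm, stdForm]; field_simp
    · simp [actForm, stdForm]; field_simp; linear_combination -hm

end Classification

section Counting

variable {K : Type*} [Field K] [Fintype K]

/-- The quadratic character of a finite field, with complex values. -/
def quadC (x : K) : ℂ := ((quadraticChar K x : ℤ) : ℂ)

theorem quadC_zero : quadC (0 : K) = 0 := by simp [quadC]

theorem quadC_mul (x y : K) : quadC (x * y) = quadC x * quadC y := by
  rw [quadC, map_mul, Int.cast_mul]; rfl

theorem quadC_sq {x : K} (hx : x ≠ 0) : quadC x ^ 2 = 1 := by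
  rw [quadC, ← Int.cast_pow, quadraticChar_sq_one hx, Int.cast_one]

theorem quadC_sq_eq_ite (x : K) : quadC x ^ 2 = if x = 0 then 0 else 1 := by
  split_ifs with h
  · simp [h, quadC_zero]
  · exact quadC_sq h

theorem quadC_pow_two (x : K) : quadC (x ^ 2) = if x = 0 then 0 else 1 := by
  rw [sq, quadC_mul, ← sq, quadC_sq_eq_ite]

theorem sum_quadC (h2 : (2 : K) ≠ 0) : ∑ x : K, quadC x = 0 := by
  have h : ringChar K ≠ 2 := ringChar_ne_two h2
  simp only [quadC, ← Int.cast_sum, quadraticChar_sum_zero h, Int.cast_zero]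

theorem sum_ite_ne_zero (k : ℂ) :
    ∑ x : K, (if x = 0 then 0 else k) = (Fintype.card K - 1) * k := by
  have : ∀ x : K, (if x = 0 then 0 else k) = k - if x = 0 then k else 0 := by
    intro x; split_ifs <;> simp
  simp [this, Finset.sum_sub_distrib, sub_mul]

theorem sum_quadC_sub_mul (h2 : (2 : K) ≠ 0) (u : K) {k : K} (hk : k ≠ 0) :
    ∑ x : K, quadC (u - k * x) = 0 := by
  rw [← sum_quadC h2]
  refine Function.Bijective.sum_comp (Finite.injective_iff_bijective.1 fun x y h => ?_) quadC
  simpa [hk] using h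

theorem sum_quadC_sq_sub_mul (u : K) {k : K} (hk : k ≠ 0) :
    ∑ x : K, quadC (u - k * x) ^ 2 = Fintype.card K - 1 := by
  rw [← mul_one (_ - 1 : ℂ), ← sum_ite_ne_zero]
  simp only [quadC_sq_eq_ite]
  refine Function.Bijective.sum_comp (Finite.injective_iff_bijective.1 fun x y h => ?_)
    (fun x : K => if x = 0 then (0 : ℂ) else 1)
  simpa [hk] using h

/-- The number of points of the hyperbola `w² = t² - l`, in terms of the quadratic character. -/
theorem sum_quadC_sq_sub (h2 : (2 : K) ≠ 0) {l : K} (hl : l ≠ 0) :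
    ∑ t : K, quadC (t ^ 2 - l) = -1 := by
  have hchar : ringChar K ≠ 2 := ringChar_ne_two h2
  have hroots : ∀ a : K, quadC a = ∑ w : K, (if w ^ 2 = a then (1 : ℂ) else 0) - 1 := by
    intro a
    have h := congrArg (Int.cast : ℤ → ℂ) (quadraticChar_card_sqrts hchar a)
    push_cast at h
    rw [quadC, Finset.sum_boole, eq_sub_iff_add_eq, ← h]
    congr 2
    ext; simp
  have hcount : ∑ t : K, ∑ w : K, (if w ^ 2 = t ^ 2 - l then (1 : ℂ) else 0) =
      Fintype.card K - 1 := by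
    have hinner : ∀ s : K, ∑ t : K, (if (s + t) ^ 2 = t ^ 2 - l then (1 : ℂ) else 0) =
        if s = 0 then 0 else 1 := by
      intro s
      split_ifs with hs
      · refine Finset.sum_eq_zero fun t _ => if_neg fun h => hl ?_
        rw [hs] at h
        linear_combination h
      · rw [Finset.sum_eq_single (-(l + s ^ 2) / (2 * s))]
        · rw [if_pos]; field_simp; ring
        · intro t _ ht
          rw [if_neg]
          intro h
          apply ht
          field_simp
          linear_combination h
        · simp
    rw [← mul_one (_ - 1 : ℂ), ← sum_ite_ne_zero, ← Finset.sum_congr rfl fun s _ => hinner s,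
      Finset.sum_comm (f := fun s t => if (s + t) ^ 2 = t ^ 2 - l then (1 : ℂ) else 0)]
    refine Finset.sum_congr rfl fun t _ => ?_
    exact (Equiv.sum_comp (Equiv.addRight t) fun w => if w ^ 2 = t ^ 2 - l then (1 : ℂ) else 0).symm
  simp only [hroots, Finset.sum_sub_distrib, hcount]
  simp

/-- The discriminant of `u² - lv²`-type norm forms is equidistributed among the classes. -/
theorem sum_quadC_norm (h2 : (2 : K) ≠ 0) {l : K} (hl : l ≠ 0) :
    ∑ z : K, ∑ y : K, quadC (y ^ 2 - 4 * l * z ^ 2) = 0 := by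
  have hinner : ∀ z : K, ∑ y : K, quadC (y ^ 2 - 4 * l * z ^ 2) =
      if z = 0 then (Fintype.card K - 1 : ℂ) else -1 := by
    intro z
    split_ifs with hz
    · simp [hz, quadC_pow_two, sum_ite_ne_zero]
    · have h2z : 2 * z ≠ 0 := mul_ne_zero h2 hz
      rw [← sum_quadC_sq_sub h2 hl, ← Equiv.sum_comp (Equiv.mulLeft₀ (2 * z) h2z)]
      refine Finset.sum_congr rfl fun t _ => ?_
      have : (2 * z * t) ^ 2 - 4 * l * z ^ 2 = (2 * z) ^ 2 * (t ^ 2 - l) := by ring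
      simp [this, quadC_mul, quadC_pow_two, h2, hz]
  have : ∀ z : K, (if z = 0 then (Fintype.card K - 1 : ℂ) else -1) =
      (if z = 0 then (Fintype.card K : ℂ) else 0) - 1 := by
    intro z; split_ifs <;> simp
  simp [hinner, this, Finset.sum_sub_distrib]

theorem typeInd_eq (t : Fin 3) (x : Fin 3 → K) :
    typeInd t x = ![1 - quadC (discForm x) ^ 2 - (if x = 0 then 1 else 0),
      (quadC (discForm x) ^ 2 + quadC (discForm x)) / 2,
      (quadC (discForm x) ^ 2 - quadC (discForm x)) / 2] t := by
  by_cases hx : x = 0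
  · have : discForm (0 : Fin 3 → K) = 0 := by simp [discForm]
    fin_cases t <;> simp [typeInd, hx, this, quadC_zero]
  by_cases hD : discForm x = 0
  · fin_cases t <;> simp [typeInd, formType, hx, hD, quadC_zero]
  by_cases hS : IsSquare (discForm x)
  · have : quadC (discForm x) = 1 := by
      rw [quadC, (quadraticChar_one_iff_isSquare hD).2 hS, Int.cast_one]
    fin_cases t <;> simp [typeInd, formType, hx, hD, hS, this]
  · have : quadC (discForm x) = -1 := by
      rw [quadC, quadraticChar_neg_one_iff_not_isSquare.2 hS]; simp
    fin_cases t <;> simp [typeInd, formType, hx, hD, hS, this]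

/-- A weighted count of forms of a given type in terms of character sums. -/
theorem sum_typeInd_mul (w : (Fin 3 → K) → ℂ) (hw : w 0 = 1) {s₀ s₁ s₂ : ℂ}
    (h₀ : ∑ x, w x = s₀) (h₁ : ∑ x, quadC (discForm x) * w x = s₁)
    (h₂ : ∑ x, quadC (discForm x) ^ 2 * w x = s₂) (t : Fin 3) :
    ∑ x, typeInd t x * w x = ![s₀ - s₂ - 1, (s₂ + s₁) / 2, (s₂ - s₁) / 2] t := by
  simp only [typeInd_eq]
  fin_cases t
  · simp [sub_mul, Finset.sum_sub_distrib, h₀, h₂, hw]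
  · simp [div_mul_eq_mul_div, add_mul, ← Finset.sum_div, Finset.sum_add_distrib, h₁, h₂]
  · simp [div_mul_eq_mul_div, sub_mul, ← Finset.sum_div, Finset.sum_sub_distrib, h₁, h₂]

theorem sum_forms {K : Type*} [Fintype K] (f : (Fin 3 → K) → ℂ) :
    ∑ x, f x = ∑ a : K, ∑ b : K, ∑ c : K, f ![a, b, c] := by
  rw [← (Fin.consEquiv fun _ => K).sum_comp, Fintype.sum_prod_type]
  refine Finset.sum_congr rfl fun a _ => ?_
  rw [← (Fin.consEquiv fun _ => K).sum_comp, Fintype.sum_prod_type]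
  refine Finset.sum_congr rfl fun b _ => ?_
  rw [← (Fin.consEquiv fun _ => K).sum_comp, Fintype.sum_prod_type]
  refine Finset.sum_congr rfl fun c _ => ?_
  rw [Fintype.sum_unique]
  exact congrArg f (funext_three rfl rfl rfl)

theorem sum_mul_ite_eq {K : Type*} [Fintype K] [DecidableEq K] (g : K → ℂ) (z : K) :
    ∑ x, g x * (if x = z then 1 else 0) = g z := by
  rw [Finset.sum_eq_single z] <;> simp +contextual

theorem sum_forms_mul_ite_two (f : (Fin 3 → K) → ℂ) :
    ∑ x, f x * (if x 2 = 0 then 1 else 0) = ∑ a : K, ∑ b : K, f ![a, b, 0] := by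
  rw [sum_forms]
  exact Finset.sum_congr rfl fun a _ => Finset.sum_congr rfl fun b _ =>
    sum_mul_ite_eq (fun c => f ![a, b, c]) 0

theorem sum_forms_mul_ite_one (f : (Fin 3 → K) → ℂ) :
    ∑ x, f x * (if x 1 = 0 then 1 else 0) = ∑ a : K, ∑ c : K, f ![a, 0, c] := by
  rw [sum_forms]
  refine Finset.sum_congr rfl fun a _ => ?_
  rw [Finset.sum_comm]
  exact Finset.sum_congr rfl fun c _ => sum_mul_ite_eq (fun b => f ![a, b, c]) 0

theorem sum_forms_mul_ite_zero (l : K) (f : (Fin 3 → K) → ℂ) :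
    ∑ x, f x * (if x 0 = l * x 2 then 1 else 0) = ∑ c : K, ∑ b : K, f ![l * c, b, c] := by
  rw [sum_forms, Finset.sum_congr rfl fun a _ => Finset.sum_comm, Finset.sum_comm]
  refine Finset.sum_congr rfl fun c _ => ?_
  rw [Finset.sum_comm]
  exact Finset.sum_congr rfl fun b _ => sum_mul_ite_eq (fun a => f ![a, b, c]) (l * c)

/-- The number of nonzero forms of each type, over a field with `q` elements. -/
def typeCount (q : ℂ) : Fin 3 → ℂ :=
  ![q ^ 2 - 1, (q - 1) * q * (q + 1) / 2, (q - 1) ^ 2 * q / 2]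

theorem sum_typeInd (h2 : (2 : K) ≠ 0) (t : Fin 3) :
    ∑ x : Fin 3 → K, typeInd t x = typeCount (Fintype.card K) t := by
  set q : ℂ := ((Fintype.card K : ℕ) : ℂ) with hq
  have h4 : (4 : K) ≠ 0 := by
    have : (4 : K) = 2 * 2 := by norm_num
    rw [this]; exact mul_ne_zero h2 h2
  have h := sum_typeInd_mul (K := K) (fun _ => 1) rfl (s₀ := q ^ 3) (s₁ := q * (q - 1))
    (s₂ := q ^ 3 - q ^ 2) ?_ ?_ ?_ t
  · simp only [mul_one] at h
    rw [h, typeCount]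
    fin_cases t <;> simp <;> ring
  · simp [hq]
  · have : ∀ a : K, ∑ b : K, ∑ c : K, quadC (b ^ 2 - 4 * a * c) =
        if a = 0 then q * (q - 1) else 0 := by
      intro a
      split_ifs with ha
      · simp [ha, quadC_pow_two, sum_ite_ne_zero, hq, mul_comm]
      · simp [sum_quadC_sub_mul h2 _ (mul_ne_zero h4 ha)]
    simp [sum_forms, discForm, this]
  · have : ∀ a : K, ∑ b : K, ∑ c : K, quadC (b ^ 2 - 4 * a * c) ^ 2 = q * (q - 1) := by
      intro a
      by_cases ha : a = 0
      · simp [ha, quadC_sq_eq_ite, sum_ite_ne_zero, hq, mul_comm]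
      · simp [sum_quadC_sq_sub_mul _ (mul_ne_zero h4 ha), hq, mul_sub]
    simp [sum_forms, discForm, this, ← hq]
    ring

/-- The number of forms of type `t` orthogonal to a given form of type `s`,
over a field with `q` elements. -/
def orthoCount (q : ℂ) (t s : Fin 3) : ℂ :=
  !![q - 1, 2 * (q - 1), 0;
     q * (q - 1), (q - 1) ^ 2 / 2, (q ^ 2 - 1) / 2;
     0, (q - 1) ^ 2 / 2, (q ^ 2 - 1) / 2] t s

theorem sum_typeInd_ortho_stdForm (h2 : (2 : K) ≠ 0) {l : K} (hl : ¬ IsSquare l) (t s : Fin 3) :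
    ∑ x, typeInd t x * (if pairForm x (stdForm l s) = 0 then 1 else 0) =
      orthoCount (Fintype.card K) t s := by
  set q : ℂ := ((Fintype.card K : ℕ) : ℂ) with hq
  have hl0 : l ≠ 0 := fun h => hl (h ▸ IsSquare.zero)
  have h4 : (4 : K) ≠ 0 := by
    have : (4 : K) = 2 * 2 := by norm_num
    rw [this]; exact mul_ne_zero h2 h2
  fin_cases s
  · have hp : ∀ x, pairForm x (stdForm l 0) = 0 ↔ x 2 = 0 := by simp [pairForm, stdForm]
    simp only [Fin.zero_eta, hp]
    rw [sum_typeInd_mul (fun x => if x 2 = 0 then 1 else 0) (by simp)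
      (s₀ := q ^ 2) (s₁ := q * (q - 1)) (s₂ := q * (q - 1))]
    · fin_cases t <;> simp [orthoCount]
      ring
    · simpa [sq] using sum_forms_mul_ite_two (K := K) fun _ => 1
    · rw [sum_forms_mul_ite_two]
      simp [discForm, quadC_pow_two, sum_ite_ne_zero, hq, mul_sub]
    · rw [sum_forms_mul_ite_two]
      simp [discForm, quadC_sq_eq_ite, sum_ite_ne_zero, hq, mul_sub]
  · have hp : ∀ x, pairForm x (stdForm l 1) = 0 ↔ x 1 = 0 := by simp [pairForm, stdForm, h2]
    simp only [Fin.mk_one, hp]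
    rw [sum_typeInd_mul (fun x => if x 1 = 0 then 1 else 0) (by simp)
      (s₀ := q ^ 2) (s₁ := 0) (s₂ := (q - 1) ^ 2)]
    · fin_cases t <;> simp [orthoCount]
      ring
    · simpa [sq] using sum_forms_mul_ite_one (K := K) fun _ => 1
    · rw [sum_forms_mul_ite_one]
      simp [discForm, ← neg_mul, quadC_mul, ← Finset.mul_sum, sum_quadC h2]
    · rw [sum_forms_mul_ite_one]
      have : ∀ a : K, ∑ c : K, quadC (discForm ![a, 0, c]) ^ 2 = if a = 0 then 0 else q - 1 := by
        intro a
        split_ifs with ha <;> simp [discForm, quadC_sq_eq_ite, h4, ha, sum_ite_ne_zero, hq]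
      simp only [this, sum_ite_ne_zero]
      ring
  · have hp : ∀ x, pairForm x (stdForm l 2) = 0 ↔ x 0 = l * x 2 := by
      intro x
      simp only [pairForm, stdForm]
      simp
      constructor <;> intro h <;> linear_combination h
    simp only [Fin.reduceFinMk, hp]
    rw [sum_typeInd_mul (fun x => if x 0 = l * x 2 then 1 else 0) (by simp)
      (s₀ := q ^ 2) (s₁ := 0) (s₂ := q ^ 2 - 1)]
    · fin_cases t <;> simp [orthoCount]
    · simpa [sq] using sum_forms_mul_ite_zero (K := K) l fun _ => 1
    · rw [sum_forms_mul_ite_zero, ← sum_quadC_norm h2 hl0]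
      refine Finset.sum_congr rfl fun c _ => Finset.sum_congr rfl fun b _ => ?_
      simp [discForm]; ring_nf
    · rw [sum_forms_mul_ite_zero]
      have : ∀ c : K, ∑ b : K, quadC (discForm ![l * c, b, c]) ^ 2 =
          q - if c = 0 then 1 else 0 := by
        intro c
        split_ifs with hc
        · simp [discForm, quadC_sq_eq_ite, hc, sum_ite_ne_zero, hq]
        · have : ∀ b : K, discForm ![l * c, b, c] ≠ 0 := by
            intro b h
            refine hl ⟨b / (2 * c), ?_⟩
            simp [discForm] at h
            field_simp
            linear_combination -h
          simp [quadC_sq (this _), hq]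
      simp [this, Finset.sum_sub_distrib, ← hq]
      ring

end Counting

section Lines

variable {K : Type*} [Field K]

theorem typeInd_zero (t : Fin 3) : typeInd t (0 : Fin 3 → K) = 0 := by simp [typeInd]

theorem typeInd_of_ne_zero (t : Fin 3) {C : Fin 3 → K} (hC : C ≠ 0) :
    typeInd t C = if formType C = t then 1 else 0 := by simp [typeInd, hC]

/-- The pair `x` consists of multiples of a common form of type `t`, not both zero. -/
def IsLine (t : Fin 3) (x : (Fin 3 → K) × (Fin 3 → K)) : Prop :=
  ∃ (C : Fin 3 → K) (s u : K), C ≠ 0 ∧ formType C = t ∧ (s ≠ 0 ∨ u ≠ 0) ∧ x = (s • C, u • C)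

theorem eq_zero_or_isLine_or_crossForm_ne_zero (h2 : (2 : K) ≠ 0)
    (x : (Fin 3 → K) × (Fin 3 → K)) :
    x = 0 ∨ (∃ (C : Fin 3 → K) (s u : K), C ≠ 0 ∧ (s ≠ 0 ∨ u ≠ 0) ∧ x = (s • C, u • C)) ∨
      crossForm x.1 x.2 ≠ 0 := by
  obtain ⟨A, B⟩ := x
  by_cases h : crossForm A B = 0
  · by_cases hA : A = 0
    · by_cases hB : B = 0
      · simp [hA, hB]
      · exact Or.inr (Or.inl ⟨B, 0, 1, hB, by simp, by simp [hA]⟩)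
    · obtain ⟨u, rfl⟩ := exists_smul_of_crossForm_eq_zero h2 hA h
      exact Or.inr (Or.inl ⟨A, 1, u, hA, by simp, by simp⟩)
  · simp [h]

theorem not_isLine_zero (t : Fin 3) : ¬ IsLine t (0 : (Fin 3 → K) × (Fin 3 → K)) := by
  rintro ⟨C, s, u, hC, -, hsu, h⟩
  rw [eq_comm, Prod.mk_eq_zero] at h
  simp [hC] at h
  tauto

theorem IsLine.crossForm_eq_zero {t : Fin 3} {x : (Fin 3 → K) × (Fin 3 → K)} (h : IsLine t x) :
    crossForm x.1 x.2 = 0 := by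
  obtain ⟨C, s, u, -, -, -, rfl⟩ := h
  exact crossForm_smul_smul s u C

/-- For proportional pairs, being spanned by `D` only depends on the common direction. -/
theorem exists_smul_iff {C D : Fin 3 → K} (hC : C ≠ 0) (hD : D ≠ 0) {s u : K}
    (hsu : s ≠ 0 ∨ u ≠ 0) :
    (∃ s' u' : K, s • C = s' • D ∧ u • C = u' • D) ↔ ∃ k : K, D = k • C := by
  constructor
  · rintro ⟨s', u', hs, hu⟩
    rcases hsu with h | h
    · have : s' ≠ 0 := by
        rintro rfl
        simp [h, hC] at hs
      exact ⟨s'⁻¹ * s, by rw [mul_smul, hs, inv_smul_smul₀ this]⟩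
    · have : u' ≠ 0 := by
        rintro rfl
        simp [h, hC] at hu
      exact ⟨u'⁻¹ * u, by rw [mul_smul, hu, inv_smul_smul₀ this]⟩
  · rintro ⟨k, rfl⟩
    have hk : k ≠ 0 := by
      rintro rfl
      simp at hD
    exact ⟨s * k⁻¹, u * k⁻¹, by simp [smul_smul, hk]⟩

theorem isLine_smul_iff {C : Fin 3 → K} (hC : C ≠ 0) {s u : K} (hsu : s ≠ 0 ∨ u ≠ 0)
    (t : Fin 3) : IsLine t (s • C, u • C) ↔ formType C = t := by
  constructor
  · rintro ⟨D, s', u', hD, rfl, -, h⟩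
    obtain ⟨k, rfl⟩ := (exists_smul_iff hC hD hsu).1 ⟨s', u', Prod.mk.inj h⟩
    refine (formType_smul ?_ C).symm
    rintro rfl
    simp at hD
  · exact fun h => ⟨C, s, u, hC, h, hsu, rfl⟩

end Lines

section Incidence

variable {K : Type*} [Field K] [Fintype K]

/-- The number of forms of type `t` orthogonal to a nonzero form. -/
theorem sum_typeInd_ortho (h2 : (2 : K) ≠ 0) {l : K} (hl : ¬ IsSquare l) (t : Fin 3)
    {y : Fin 3 → K} (hy : y ≠ 0) :
    ∑ x, typeInd t x * (if pairForm x y = 0 then 1 else 0) =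
      orthoCount (Fintype.card K) t (formType y) := by
  obtain ⟨k, a, b, c, d, hk, hdet, e⟩ := exists_smul_actForm_stdForm h2 hl hy
  have hdet' : a * d - c * b ≠ 0 := by rwa [mul_comm c b]
  rw [← sum_typeInd_ortho_stdForm h2 hl]
  refine Function.Bijective.sum_comp
    (e := actForm a c b d) (Finite.injective_iff_bijective.1 (actForm_injective hdet'))
    (fun x => typeInd t x * (if pairForm x (stdForm l (formType y)) = 0 then 1 else 0)) ▸
    Finset.sum_congr rfl fun x _ => ?_
  rw [typeInd_actForm hdet', ← pairForm_actForm h2]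
  conv_lhs => rw [e, pairForm_smul_right]
  simp [hk]

/-- The indicator function of the line spanned by a nonzero form `C`. -/
def spanInd (C x : Fin 3 → K) : ℂ := ∑ s : K, if x = s • C then 1 else 0

/-- The indicator function of the orthogonal complement of `C`. -/
def perpInd (C x : Fin 3 → K) : ℂ := if pairForm C x = 0 then 1 else 0

theorem spanInd_smul {C : Fin 3 → K} (hC : C ≠ 0) (s : K) : spanInd C (s • C) = 1 := by
  simp [spanInd, (smul_left_injective K hC).eq_iff]

theorem spanInd_eq_zero {C x : Fin 3 → K} (h : ∀ s : K, x ≠ s • C) : spanInd C x = 0 := by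
  simp [spanInd, h]

theorem spanInd_mul_spanInd {C D : Fin 3 → K} (hC : C ≠ 0) (hD : D ≠ 0) {s u : K}
    (hsu : s ≠ 0 ∨ u ≠ 0) : spanInd D (s • C) * spanInd D (u • C) = spanInd C D := by
  by_cases h : ∃ k : K, D = k • C
  · obtain ⟨s', u', hs, hu⟩ := (exists_smul_iff hC hD hsu).2 h
    obtain ⟨k, rfl⟩ := h
    rw [spanInd_smul hC, hs, hu, spanInd_smul hD, spanInd_smul hD, one_mul]
  · rw [spanInd_eq_zero (C := C) (not_exists.1 h), mul_eq_zero]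
    by_contra! hne
    refine h ((exists_smul_iff hC hD hsu).1 ?_)
    by_contra! hn
    rcases em (∃ s' : K, s • C = s' • D) with ⟨s', hs⟩ | hs
    · exact hne.2 (spanInd_eq_zero fun u' => hn s' u' hs)
    · exact hne.1 (spanInd_eq_zero fun s' e => hs ⟨s', e⟩)

theorem sum_typeInd_mul_spanInd (t : Fin 3) (C : Fin 3 → K) :
    ∑ D, typeInd t D * spanInd C D = (Fintype.card K - 1) * typeInd t C := by
  have h : ∀ s : K, ∑ D, typeInd t D * (if D = s • C then 1 else 0) =
      if s = 0 then 0 else typeInd t C := by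
    intro s
    rw [sum_mul_ite_eq]
    split_ifs with hs
    · simp [hs, typeInd_zero]
    · exact typeInd_smul hs t C
  simp only [spanInd, Finset.mul_sum]
  rw [Finset.sum_comm, Finset.sum_congr rfl fun s _ => h s, sum_ite_ne_zero]

/-- The number of forms of type `t` spanning a line that contains both members of a pair. -/
theorem sum_typeInd_mul_span (h2 : (2 : K) ≠ 0) (t : Fin 3) (x : (Fin 3 → K) × (Fin 3 → K)) :
    ∑ C, typeInd t C * (spanInd C x.1 * spanInd C x.2) =
      typeCount (Fintype.card K) t * (if x = 0 then 1 else 0) +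
        (Fintype.card K - 1) * (if IsLine t x then 1 else 0) := by
  have hcongr : ∀ f g : (Fin 3 → K) → ℂ, (∀ C, C ≠ 0 → f C = g C) →
      ∑ C, typeInd t C * f C = ∑ C, typeInd t C * g C := by
    refine fun f g h => Finset.sum_congr rfl fun C _ => ?_
    by_cases hC : C = 0
    · simp [hC, typeInd_zero]
    · rw [h C hC]
  rcases eq_zero_or_isLine_or_crossForm_ne_zero h2 x with rfl | ⟨C, s, u, hC, hsu, rfl⟩ | hx
  · rw [hcongr _ (fun _ => 1) fun C hC => by
      have : spanInd C 0 = 1 := by simpa using spanInd_smul hC 0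
      simp [this]]
    simp [not_isLine_zero, sum_typeInd h2]
  · have hne : (s • C, u • C) ≠ 0 := by
      rw [Ne, Prod.mk_eq_zero]
      simp [hC]
      tauto
    rw [hcongr _ _ fun D hD => spanInd_mul_spanInd hC hD hsu, sum_typeInd_mul_spanInd]
    simp [hne, isLine_smul_iff hC hsu, typeInd_of_ne_zero t hC]
  · have h0 : x ≠ 0 := by
      rintro rfl
      exact hx (by simpa using crossForm_smul_smul (0 : K) 0 0)
    have h1 : ¬ IsLine t x := fun h => hx h.crossForm_eq_zero
    rw [if_neg h0, if_neg h1, hcongr _ (fun _ => 0)]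
    · simp
    · intro C hC
      rw [mul_eq_zero]
      by_contra! hne
      obtain ⟨s, hs⟩ : ∃ s : K, x.1 = s • C := by
        by_contra! h; exact hne.1 (spanInd_eq_zero h)
      obtain ⟨u, hu⟩ : ∃ u : K, x.2 = u • C := by
        by_contra! h; exact hne.2 (spanInd_eq_zero h)
      exact hx (by rw [hs, hu, crossForm_smul_smul])

/-- The number of forms of type `t` orthogonal to both members of a pair. -/
theorem sum_typeInd_mul_perp (h2 : (2 : K) ≠ 0) {l : K} (hl : ¬ IsSquare l) (t : Fin 3)
    (x : (Fin 3 → K) × (Fin 3 → K)) :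
    ∑ C, typeInd t C * (perpInd C x.1 * perpInd C x.2) =
      typeCount (Fintype.card K) t * (if x = 0 then 1 else 0) +
        ∑ s, orthoCount (Fintype.card K) t s * (if IsLine s x then 1 else 0) +
        (Fintype.card K - 1) * typeInd t (crossForm x.1 x.2) := by
  rcases eq_zero_or_isLine_or_crossForm_ne_zero h2 x with rfl | ⟨C, s, u, hC, hsu, rfl⟩ | hx
  · have hp : ∀ C : Fin 3 → K, perpInd C 0 = 1 := fun C => by simp [perpInd, pairForm]
    have hc : crossForm (0 : Fin 3 → K) 0 = 0 := by simpa using crossForm_smul_smul (0 : K) 0 0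
    simp [not_isLine_zero, sum_typeInd h2, hp, hc, typeInd_zero]
  · have hne : (s • C, u • C) ≠ 0 := by
      rw [Ne, Prod.mk_eq_zero]
      simp [hC]
      tauto
    have hp : ∀ D, perpInd D (s • C) * perpInd D (u • C) =
        if pairForm D C = 0 then 1 else 0 := by
      intro D
      simp only [perpInd, pairForm_smul_right, mul_eq_zero]
      rcases hsu with h | h <;> by_cases h' : pairForm D C = 0 <;> simp [h, h']
    simp only [hp, sum_typeInd_ortho h2 hl t hC]
    simp [hne, isLine_smul_iff hC hsu, crossForm_smul_smul, typeInd_zero]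
  · have h0 : x ≠ 0 := by
      rintro rfl
      exact hx (by simpa using crossForm_smul_smul (0 : K) 0 0)
    have h1 : ∀ s, ¬ IsLine s x := fun s h => hx h.crossForm_eq_zero
    have hp : ∀ D, perpInd D x.1 * perpInd D x.2 = spanInd (crossForm x.1 x.2) D := by
      intro D
      by_cases h : pairForm D x.1 = 0 ∧ pairForm D x.2 = 0
      · obtain ⟨k, rfl⟩ := exists_smul_crossForm h2 hx h.1 h.2
        simp [perpInd, h, spanInd_smul hx]
      · rw [spanInd_eq_zero]
        · simp only [perpInd]
          rw [not_and_or] at h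
          rcases h with h | h <;> simp [h]
        · rintro k rfl
          exact h (by simp [pairForm_smul_left, pairForm_crossForm_left h2,
            pairForm_crossForm_right h2])
    simp only [hp, sum_typeInd_mul_spanInd, h0, h1]
    simp

end Incidence

section Fourier

variable {K : Type*} [Field K] [Fintype K] {ψ : AddChar K ℂ}

theorem sum_addChar_pairForm (h2 : (2 : K) ≠ 0) (hψ : ψ.IsPrimitive) (y : Fin 3 → K) :
    ∑ x, ψ (pairForm x y) = if y = 0 then (Fintype.card K : ℂ) ^ 3 else 0 := by
  have hψ' : ∀ k : K, ∑ x, ψ (x * k) = if k = 0 then (Fintype.card K : ℂ) else 0 := fun k => by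
    rw [AddChar.sum_mulShift k hψ]; split_ifs <;> simp
  have h : ∀ a b c : K, ψ (pairForm ![a, b, c] y) =
      ψ (a * y 0) * (ψ (b * (y 1 / 2)) * ψ (c * y 2)) := by
    intro a b c
    rw [← AddChar.map_add_eq_mul, ← AddChar.map_add_eq_mul]
    simp [pairForm]; ring_nf
  simp only [sum_forms, h, ← Finset.mul_sum, ← Finset.sum_mul, hψ']
  by_cases hy : y = 0
  · simp [hy]; ring
  · rw [if_neg hy]
    by_contra hne
    simp [h2] at hne
    exact hy (funext_three hne.2.2 hne.2.1 hne.1)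

theorem sum_addChar_mul_smul (hψ : ψ.IsPrimitive) (C y : Fin 3 → K) :
    ∑ s : K, ψ (pairForm (s • C) y) = Fintype.card K * perpInd C y := by
  simp only [pairForm_smul_left, AddChar.sum_mulShift _ hψ, perpInd]
  split_ifs <;> simp

theorem sum_spanInd_mul_addChar (hψ : ψ.IsPrimitive) (C y : Fin 3 → K) :
    ∑ x, spanInd C x * ψ (pairForm x y) = Fintype.card K * perpInd C y := by
  rw [← sum_addChar_mul_smul hψ]
  simp only [spanInd, Finset.sum_mul]
  rw [Finset.sum_comm]
  refine Finset.sum_congr rfl fun s _ => ?_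
  simp only [mul_comm _ (ψ _)]
  exact sum_mul_ite_eq (fun x => ψ (pairForm x y)) (s • C)

theorem sum_perpInd_mul_addChar (h2 : (2 : K) ≠ 0) (hψ : ψ.IsPrimitive) (C y : Fin 3 → K) :
    ∑ x, perpInd C x * ψ (pairForm x y) = (Fintype.card K : ℂ) ^ 2 * spanInd C y := by
  have hq : (Fintype.card K : ℂ) ≠ 0 := Nat.cast_ne_zero.2 Fintype.card_ne_zero
  have h : ∀ s : K, ∑ x, ψ (pairForm (s • C) x) * ψ (pairForm x y) =
      (Fintype.card K : ℂ) ^ 3 * if y = (-s) • C then 1 else 0 := by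
    intro s
    have : ∀ x, ψ (pairForm (s • C) x) * ψ (pairForm x y) = ψ (pairForm x (s • C + y)) := by
      intro x
      rw [pairForm_add_right, AddChar.map_add_eq_mul, pairForm_comm x (s • C)]
    simp only [this, sum_addChar_pairForm h2 hψ, neg_smul, eq_neg_iff_add_eq_zero, add_comm y]
    split_ifs <;> simp
  apply mul_left_cancel₀ hq
  simp only [Finset.mul_sum, ← mul_assoc, ← sum_addChar_mul_smul hψ, Finset.sum_mul, spanInd]
  rw [Finset.sum_comm, Finset.sum_congr rfl fun s _ => h s,
    ← Equiv.sum_comp (Equiv.neg K)]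
  simp only [Equiv.neg_apply, neg_neg]
  exact Finset.sum_congr rfl fun s _ => by ring

/-- The unnormalized Fourier transform on pairs of forms. -/
def pairFT (ψ : AddChar K ℂ) (Φ : (Fin 3 → K) × (Fin 3 → K) → ℂ) (y : (Fin 3 → K) × (Fin 3 → K)) :
    ℂ :=
  ∑ x, Φ x * ψ (pairForm x.1 y.1 + pairForm x.2 y.2)

theorem pairFT_add (Φ Ψ : (Fin 3 → K) × (Fin 3 → K) → ℂ) (y : (Fin 3 → K) × (Fin 3 → K)) :
    pairFT ψ (fun x => Φ x + Ψ x) y = pairFT ψ Φ y + pairFT ψ Ψ y := by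
  simp [pairFT, add_mul, Finset.sum_add_distrib]

theorem pairFT_const_mul (k : ℂ) (Φ : (Fin 3 → K) × (Fin 3 → K) → ℂ)
    (y : (Fin 3 → K) × (Fin 3 → K)) :
    pairFT ψ (fun x => k * Φ x) y = k * pairFT ψ Φ y := by
  simp [pairFT, mul_assoc, Finset.mul_sum]

theorem pairFT_sum {ι : Type*} [Fintype ι] (Φ : ι → (Fin 3 → K) × (Fin 3 → K) → ℂ)
    (y : (Fin 3 → K) × (Fin 3 → K)) :
    pairFT ψ (fun x => ∑ i, Φ i x) y = ∑ i, pairFT ψ (Φ i) y := by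
  simp only [pairFT, Finset.sum_mul]
  exact Finset.sum_comm

theorem pairFT_mul (f g : (Fin 3 → K) → ℂ) (y : (Fin 3 → K) × (Fin 3 → K)) :
    pairFT ψ (fun x => f x.1 * g x.2) y =
      (∑ x, f x * ψ (pairForm x y.1)) * ∑ x, g x * ψ (pairForm x y.2) := by
  simp only [pairFT, Fintype.sum_prod_type, Finset.sum_mul_sum, AddChar.map_add_eq_mul]
  exact Finset.sum_congr rfl fun _ _ => Finset.sum_congr rfl fun _ _ => by ring

theorem pairFT_zero_ind (y : (Fin 3 → K) × (Fin 3 → K)) :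
    pairFT ψ (fun x => if x = 0 then 1 else 0) y = 1 := by
  simp [pairFT, pairForm]

/-- The Fourier transform of the line counting function. -/
theorem typeCount_add_pairFT_isLine (h2 : (2 : K) ≠ 0) {l : K} (hl : ¬ IsSquare l)
    (hψ : ψ.IsPrimitive) (t : Fin 3) (y : (Fin 3 → K) × (Fin 3 → K)) :
    typeCount (Fintype.card K) t +
        (Fintype.card K - 1) * pairFT ψ (fun x => if IsLine t x then 1 else 0) y =
      (Fintype.card K : ℂ) ^ 2 * (typeCount (Fintype.card K) t * (if y = 0 then 1 else 0) +
        ∑ s, orthoCount (Fintype.card K) t s * (if IsLine s y then 1 else 0) +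
        (Fintype.card K - 1) * typeInd t (crossForm y.1 y.2)) := by
  rw [← sum_typeInd_mul_perp h2 hl]
  trans pairFT ψ (fun x => ∑ C, typeInd t C * (spanInd C x.1 * spanInd C x.2)) y
  · simp only [sum_typeInd_mul_span h2, pairFT_add, pairFT_const_mul, pairFT_zero_ind, mul_one]
  · simp only [pairFT_sum, pairFT_const_mul, pairFT_mul, sum_spanInd_mul_addChar hψ,
      Finset.mul_sum]
    exact Finset.sum_congr rfl fun _ _ => by ring

/-- The Fourier transform of the function counting orthogonal forms. -/
theorem typeCount_add_pairFT_crossForm (h2 : (2 : K) ≠ 0) {l : K} (hl : ¬ IsSquare l)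
    (hψ : ψ.IsPrimitive) (t : Fin 3) (y : (Fin 3 → K) × (Fin 3 → K)) :
    typeCount (Fintype.card K) t +
        ∑ s, orthoCount (Fintype.card K) t s * pairFT ψ (fun x => if IsLine s x then 1 else 0) y +
        (Fintype.card K - 1) * pairFT ψ (fun x => typeInd t (crossForm x.1 x.2)) y =
      (Fintype.card K : ℂ) ^ 4 * (typeCount (Fintype.card K) t * (if y = 0 then 1 else 0) +
        (Fintype.card K - 1) * (if IsLine t y then 1 else 0)) := by
  rw [← sum_typeInd_mul_span h2]
  trans pairFT ψ (fun x => ∑ C, typeInd t C * (perpInd C x.1 * perpInd C x.2)) y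
  · simp only [sum_typeInd_mul_perp h2 hl, pairFT_add, pairFT_sum, pairFT_const_mul,
      pairFT_zero_ind, mul_one]
  · simp only [pairFT_sum, pairFT_const_mul, pairFT_mul, sum_perpInd_mul_addChar h2 hψ,
      Finset.mul_sum]
    exact Finset.sum_congr rfl fun _ _ => by ring

end Fourier

section Orbits

variable {K : Type*} [Field K]

theorem toPolyBQ_injective : Function.Injective (toPolyBQ (F := K)) := fun x y h => by
  have e : ∀ u v : K, x 0 * u ^ 2 + x 1 * u * v + x 2 * v ^ 2 =
      y 0 * u ^ 2 + y 1 * u * v + y 2 * v ^ 2 := fun u v => by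
    simpa [toPolyBQ] using congrArg (eval ![u, v]) h
  have e0 := e 1 0
  have e1 := e 1 1
  have e2 := e 0 1
  simp at e0 e1 e2
  exact funext_three e0 (by linear_combination e1 - e0 - e2) e2

theorem subst2_toPolyBQ (g : Matrix (Fin 2) (Fin 2) K) (x : Fin 3 → K) :
    subst2 g (toPolyBQ x) = toPolyBQ (actForm (g 0 0) (g 0 1) (g 1 0) (g 1 1) x) := by
  simp [subst2, toPolyBQ, actForm, Fin.sum_univ_two, algebraMap_eq, map_ofNat C 2]
  ring

theorem C_mul_toPolyBQ_add (α β : K) (x y : Fin 3 → K) :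
    C α * toPolyBQ x + C β * toPolyBQ y = toPolyBQ (α • x + β • y) := by
  simp [toPolyBQ]
  ring

/-- Orbits in coordinates. -/
theorem inOrbitPB_iff (r x : (Fin 3 → K) × (Fin 3 → K)) :
    InOrbitPB r x ↔ ∃ α β γ δ a b c d : K, α * δ - β * γ ≠ 0 ∧ a * d - b * c ≠ 0 ∧
      x.1 = α • actForm a b c d r.1 + β • actForm a b c d r.2 ∧
      x.2 = γ • actForm a b c d r.1 + δ • actForm a b c d r.2 := by
  simp only [InOrbitPB, pairActB, subst2_toPolyBQ, C_mul_toPolyBQ_add, Prod.mk.injEq,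
    toPolyBQ_injective.eq_iff]
  constructor
  · rintro ⟨g, h, h1, h2⟩
    refine ⟨g 0 0, g 0 1, g 1 0, g 1 1, h 0 0, h 0 1, h 1 0, h 1 1, ?_, ?_, h1.symm, h2.symm⟩
    · rw [← det_fin_two]; exact g.det_ne_zero
    · rw [← det_fin_two]; exact h.det_ne_zero
  · rintro ⟨α, β, γ, δ, a, b, c, d, hg, hh, h1, h2⟩
    refine ⟨GeneralLinearGroup.mkOfDetNeZero !![α, β; γ, δ] (by rwa [det_fin_two_of]),
      GeneralLinearGroup.mkOfDetNeZero !![a, b; c, d] (by rwa [det_fin_two_of]), ?_, ?_⟩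
    · simpa [GeneralLinearGroup.mkOfDetNeZero] using h1.symm
    · simpa [GeneralLinearGroup.mkOfDetNeZero] using h2.symm

theorem inOrbitPB_zero_iff (x : (Fin 3 → K) × (Fin 3 → K)) : InOrbitPB (0, 0) x ↔ x = 0 := by
  rw [inOrbitPB_iff]
  simp only [actForm_zero, smul_zero, add_zero]
  constructor
  · rintro ⟨-, -, -, -, -, -, -, -, -, -, h1, h2⟩
    exact Prod.ext h1 h2
  · rintro rfl
    exact ⟨1, 0, 0, 1, 1, 0, 0, 1, by simp, by simp, rfl, rfl⟩

theorem inOrbitPB_stdForm_iff [Fintype K] (h2 : (2 : K) ≠ 0) {l : K} (hl : ¬ IsSquare l)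
    (t : Fin 3) (x : (Fin 3 → K) × (Fin 3 → K)) :
    InOrbitPB (0, stdForm l t) x ↔ IsLine t x := by
  rw [inOrbitPB_iff]
  simp only [actForm_zero, smul_zero, zero_add]
  constructor
  · rintro ⟨α, β, γ, δ, a, b, c, d, hg, hh, h1, h2'⟩
    refine ⟨actForm a b c d (stdForm l t), β, δ, ?_, ?_, ?_, Prod.ext h1 h2'⟩
    · rw [Ne, actForm_eq_zero_iff hh]
      exact stdForm_ne_zero l t
    · rw [formType_actForm hh, formType_stdForm h2 hl]
    · by_contra! h
      simp [h] at hg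
  · rintro ⟨C, s, u, hC, rfl, hsu, rfl⟩
    obtain ⟨k, a, b, c, d, hk, hh, e⟩ := exists_smul_actForm_stdForm h2 hl hC
    have hsmul : ∀ v : K, v • C = (v * k) • actForm a b c d (stdForm l (formType C)) := by
      intro v
      rw [mul_smul, ← e]
    rcases hsu with h | h
    · exact ⟨0, s * k, -1, u * k, a, b, c, d, by simp [h, hk], hh, hsmul s, hsmul u⟩
    · exact ⟨1, s * k, 0, u * k, a, b, c, d, by simp [h, hk], hh, hsmul s, hsmul u⟩

/-- The orbit of a pair `r` of independent forms is determined by the class of its cross product. -/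
theorem inOrbitPB_iff_of_crossForm [Fintype K] (h2 : (2 : K) ≠ 0) {l : K} (hl : ¬ IsSquare l)
    {r : (Fin 3 → K) × (Fin 3 → K)} {k : K} {t : Fin 3} (hk : k ≠ 0)
    (hr : crossForm r.1 r.2 = k • actForm 0 1 1 0 (stdForm l t))
    (x : (Fin 3 → K) × (Fin 3 → K)) :
    InOrbitPB r x ↔ crossForm x.1 x.2 ≠ 0 ∧ formType (crossForm x.1 x.2) = t := by
  have hdet : (0 : K) * 0 - 1 * 1 ≠ 0 := by simp
  have hr0 : crossForm r.1 r.2 ≠ 0 := by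
    rw [hr, smul_ne_zero_iff]
    exact ⟨hk, mt (actForm_eq_zero_iff hdet).1 (stdForm_ne_zero l t)⟩
  have hrt : formType (crossForm r.1 r.2) = t := by
    rw [hr, formType_smul hk, formType_actForm hdet, formType_stdForm h2 hl]
  constructor
  · rw [inOrbitPB_iff]
    rintro ⟨α, β, γ, δ, a, b, c, d, hg, hh, h1, h2'⟩
    have hh' : d * a - -c * -b ≠ 0 := by
      rwa [neg_mul_neg, mul_comm d, mul_comm c]
    rw [h1, h2', crossForm_combination, crossForm_actForm, smul_smul,
      formType_smul (mul_ne_zero hg hh), formType_actForm hh']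
    exact ⟨smul_ne_zero (mul_ne_zero hg hh) (by rwa [Ne, actForm_eq_zero_iff hh']), hrt⟩
  · rintro ⟨hx, rfl⟩
    obtain ⟨m, a, b, c, d, hm, hh, e⟩ := exists_smul_actForm_stdForm h2 hl hx
    have hstd : actForm a b c d (stdForm l (formType (crossForm x.1 x.2))) =
        k⁻¹ • actForm b a d c (crossForm r.1 r.2) := by
      rw [hr, actForm_smul, inv_smul_smul₀ hk]
      refine funext_three ?_ ?_ ?_ <;> (simp [actForm]; ring)
    have hh' : c * b - -d * -a ≠ 0 := fun h => hh (by linear_combination -h)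
    have hcross : crossForm (actForm c (-d) (-a) b r.1) (actForm c (-d) (-a) b r.2) =
        ((c * b - -d * -a) * k * m⁻¹) • crossForm x.1 x.2 := by
      rw [crossForm_actForm, neg_neg, neg_neg, mul_assoc, mul_smul, mul_smul]
      congr 1
      rw [e, hstd, inv_smul_smul₀ hm, smul_inv_smul₀ hk]
    have hne : crossForm (actForm c (-d) (-a) b r.1) (actForm c (-d) (-a) b r.2) ≠ 0 := by
      rw [hcross]
      exact smul_ne_zero (mul_ne_zero (mul_ne_zero hh' hk) (inv_ne_zero hm)) hx
    obtain ⟨α, β, h₁⟩ := exists_combination_of_pairForm_crossForm h2 hne (z := x.1) (by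
      rw [hcross, pairForm_smul_left, pairForm_crossForm_left h2, mul_zero])
    obtain ⟨γ, δ, h₂⟩ := exists_combination_of_pairForm_crossForm h2 hne (z := x.2) (by
      rw [hcross, pairForm_smul_left, pairForm_crossForm_right h2, mul_zero])
    refine (inOrbitPB_iff r x).2 ⟨α, β, γ, δ, c, -d, -a, b, fun h => hx ?_, hh', h₁, h₂⟩
    rw [h₁, h₂, crossForm_combination, h, zero_smul]

end Orbits

section Character

theorem exists_isPrimitive_psiF (p : ℕ) [Fact p.Prime] (K : Type*) [Field K] [Fintype K]
    [CharP K p] : ∃ ψ : AddChar K ℂ, ψ.IsPrimitive ∧ ∀ t, psiF p K t = ψ t := by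
  let : Algebra (ZMod p) K := ZMod.algebra K p
  let ψ : AddChar K ℂ :=
    (ZMod.stdAddChar (N := p)).compAddMonoidHom (Algebra.trace (ZMod p) K).toAddMonoidHom
  refine ⟨ψ, AddChar.IsPrimitive.of_ne_one fun h => ?_, fun t => ?_⟩
  · obtain ⟨t, ht⟩ := Algebra.trace_surjective (ZMod p) K 1
    have h1 : ZMod.stdAddChar (Algebra.trace (ZMod p) K t) = 1 := DFunLike.congr_fun h t
    rw [ht, ← AddChar.map_zero_eq_one (ZMod.stdAddChar (N := p))] at h1
    exact one_ne_zero (ZMod.injective_stdAddChar h1)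
  · change _ = ZMod.stdAddChar (Algebra.trace (ZMod p) K t)
    conv_rhs => rw [← ZMod.natCast_zmod_val (Algebra.trace (ZMod p) K t), ← Int.cast_natCast,
      ZMod.stdAddChar_coe]
    simp [psiF]

theorem card_pow_mul_FTPB (p : ℕ) [Fact p.Prime] {K : Type*} [Field K] [Fintype K] [CharP K p]
    {ψ : AddChar K ℂ} (hψ : ∀ t, psiF p K t = ψ t) (Φ : (Fin 3 → K) × (Fin 3 → K) → ℂ)
    (y : (Fin 3 → K) × (Fin 3 → K)) :
    (Fintype.card K : ℂ) ^ 6 * FTPB p Φ y = pairFT ψ Φ y := by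
  have hq : (Fintype.card K : ℂ) ≠ 0 := Nat.cast_ne_zero.2 Fintype.card_ne_zero
  rw [FTPB, mul_inv_cancel_left₀ (pow_ne_zero 6 hq)]
  simp only [hψ]
  rfl

end Character

section Representatives

variable {K : Type*} [Field K]

/-- The seven classes of pairs of binary quadratic forms. -/
def orbitClass : Fin 7 → (Fin 3 → K) × (Fin 3 → K) → Prop :=
  ![fun x => x = 0, IsLine 0, IsLine 1, IsLine 2,
    fun x => crossForm x.1 x.2 ≠ 0 ∧ formType (crossForm x.1 x.2) = 0,
    fun x => crossForm x.1 x.2 ≠ 0 ∧ formType (crossForm x.1 x.2) = 1,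
    fun x => crossForm x.1 x.2 ≠ 0 ∧ formType (crossForm x.1 x.2) = 2]

/-- Representatives of the seven orbits. -/
def orbitRep (l : K) : Fin 7 → (Fin 3 → K) × (Fin 3 → K) :=
  ![(![0,0,0], ![0,0,0]), (![0,0,0], ![0,0,1]), (![0,0,0], ![0,1,0]),
    (![0,0,0], ![1,0,-l]), (![0,0,1], ![0,1,0]), (![0,0,1], ![1,0,0]),
    (![0,1,0], ![1,0,l])]

theorem inOrbitPB_orbitRep_iff [Fintype K] (h2 : (2 : K) ≠ 0) {l : K} (hl : ¬ IsSquare l)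
    (j : Fin 7) (x : (Fin 3 → K) × (Fin 3 → K)) :
    InOrbitPB (orbitRep l j) x ↔ orbitClass j x := by
  have h0 : (![0, 0, 0] : Fin 3 → K) = 0 := funext_three rfl rfl rfl
  fin_cases j
  · simp only [orbitRep, h0]
    exact inOrbitPB_zero_iff x
  · simp only [orbitRep, h0]
    exact inOrbitPB_stdForm_iff h2 hl 0 x
  · simp only [orbitRep, h0]
    exact inOrbitPB_stdForm_iff h2 hl 1 x
  · simp only [orbitRep, h0]
    exact inOrbitPB_stdForm_iff h2 hl 2 x
  · refine inOrbitPB_iff_of_crossForm h2 hl (k := -1) (by simp) ?_ x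
    refine funext_three ?_ ?_ ?_ <;> simp [orbitRep, crossForm, actForm, stdForm]
  · refine inOrbitPB_iff_of_crossForm h2 hl h2 ?_ x
    refine funext_three ?_ ?_ ?_ <;> simp [orbitRep, crossForm, actForm, stdForm]
  · refine inOrbitPB_iff_of_crossForm h2 hl (k := -1) (by simp) ?_ x
    refine funext_three ?_ ?_ ?_ <;> simp [orbitRep, crossForm, actForm, stdForm]

theorem orbitClass_cases {i : Fin 7} {x : (Fin 3 → K) × (Fin 3 → K)} (h : orbitClass i x) :
    (i = 0 ∧ x = 0) ∨ (∃ t, i = ![1, 2, 3] t ∧ IsLine t x) ∨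
      i = ![4, 5, 6] (formType (crossForm x.1 x.2)) ∧ crossForm x.1 x.2 ≠ 0 := by
  fin_cases i
  · exact Or.inl ⟨rfl, h⟩
  · exact Or.inr (Or.inl ⟨0, rfl, h⟩)
  · exact Or.inr (Or.inl ⟨1, rfl, h⟩)
  · exact Or.inr (Or.inl ⟨2, rfl, h⟩)
  · exact Or.inr (Or.inr ⟨by rw [h.2]; rfl, h.1⟩)
  · exact Or.inr (Or.inr ⟨by rw [h.2]; rfl, h.1⟩)
  · exact Or.inr (Or.inr ⟨by rw [h.2]; rfl, h.1⟩)

theorem orbitClass_unique {i j : Fin 7} {x : (Fin 3 → K) × (Fin 3 → K)}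
    (hi : orbitClass i x) (hj : orbitClass j x) : i = j := by
  have hcross : x = 0 → crossForm x.1 x.2 = 0 := by
    rintro rfl
    simpa using crossForm_smul_smul (0 : K) 0 0
  rcases orbitClass_cases hi with ⟨rfl, h⟩ | ⟨s, rfl, h⟩ | ⟨rfl, h⟩ <;>
    rcases orbitClass_cases hj with ⟨rfl, h'⟩ | ⟨t, rfl, h'⟩ | ⟨rfl, h'⟩
  · rfl
  · exact absurd (h ▸ h') (not_isLine_zero t)
  · exact absurd (hcross h) h'
  · exact absurd (h' ▸ h) (not_isLine_zero s)
  · obtain ⟨C, a, b, hC, rfl, hab, rfl⟩ := h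
    rw [(isLine_smul_iff hC hab t).1 h']
  · exact absurd h.crossForm_eq_zero h'
  · exact absurd (hcross h') h
  · exact absurd h'.crossForm_eq_zero h
  · rfl

/-- Evaluation of the Fourier transform at a point with known class. -/
theorem pairFT_orbitClass [Fintype K] (h2 : (2 : K) ≠ 0) {l : K} (hl : ¬ IsSquare l)
    {ψ : AddChar K ℂ} (hψ : ψ.IsPrimitive) {i : Fin 7} {y : (Fin 3 → K) × (Fin 3 → K)}
    (hy : orbitClass i y) (E : Fin 7 → ℂ) (hE₀ : E 0 = 1)
    (hE : ∀ t, typeCount (Fintype.card K) t + (Fintype.card K - 1) * E (![1, 2, 3] t) =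
      (Fintype.card K : ℂ) ^ 2 * (typeCount (Fintype.card K) t * (if i = 0 then 1 else 0) +
        ∑ s, orthoCount (Fintype.card K) t s * (if i = ![1, 2, 3] s then 1 else 0) +
        (Fintype.card K - 1) * if i = ![4, 5, 6] t then 1 else 0))
    (hE' : ∀ t, typeCount (Fintype.card K) t +
        ∑ s, orthoCount (Fintype.card K) t s * E (![1, 2, 3] s) +
        (Fintype.card K - 1) * E (![4, 5, 6] t) =
      (Fintype.card K : ℂ) ^ 4 * (typeCount (Fintype.card K) t * (if i = 0 then 1 else 0) +
        (Fintype.card K - 1) * if i = ![1, 2, 3] t then 1 else 0)) (j : Fin 7) :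
    pairFT ψ (fun x => if orbitClass j x then 1 else 0) y = E j := by
  have hq : (Fintype.card K : ℂ) - 1 ≠ 0 :=
    sub_ne_zero.2 (Nat.cast_ne_one.2 Fintype.one_lt_card.ne')
  have hclass : ∀ j, orbitClass j y ↔ i = j := fun j =>
    ⟨orbitClass_unique hy, fun h => h ▸ hy⟩
  have hz : y = 0 ↔ i = 0 := hclass 0
  have hL : ∀ t, IsLine t y ↔ i = ![1, 2, 3] t := by
    intro t
    rw [← hclass]
    fin_cases t <;> rfl
  have hP : ∀ t (x : (Fin 3 → K) × (Fin 3 → K)), typeInd t (crossForm x.1 x.2) =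
      if orbitClass (![4, 5, 6] t) x then 1 else 0 := by
    intro t x
    fin_cases t <;> simp [typeInd, orbitClass]
  have hline : ∀ t, pairFT ψ (fun x => if IsLine t x then 1 else 0) y = E (![1, 2, 3] t) := by
    intro t
    have h := typeCount_add_pairFT_isLine h2 hl hψ t y
    simp only [hz, hL, hP, hclass, ← hE] at h
    exact mul_left_cancel₀ hq (add_left_cancel h)
  have hplane : ∀ t, pairFT ψ (fun x => if orbitClass (![4, 5, 6] t) x then 1 else 0) y =
      E (![4, 5, 6] t) := by
    intro t
    have h := typeCount_add_pairFT_crossForm h2 hl hψ t y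
    simp only [hz, hL, hP, hline, ← hE'] at h
    exact mul_left_cancel₀ hq (add_left_cancel h)
  fin_cases j
  · simpa [orbitClass, hE₀] using pairFT_zero_ind (ψ := ψ) y
  · exact hline 0
  · exact hline 1
  · exact hline 2
  · exact hplane 0
  · exact hplane 1
  · exact hplane 2

end Representatives

/-- the Fourier transform matrix for pairs of binary quadratic forms. -/
theorem stmt16 (p : ℕ) [Fact p.Prime] [CharP F p] (hp : p ≠ 2) (l : F) (hl : ¬ IsSquare l) :
    let r : Fin 7 → (Fin 3 → F) × (Fin 3 → F) :=
      ![(![0,0,0], ![0,0,0]), (![0,0,0], ![0,0,1]), (![0,0,0], ![0,1,0]),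
        (![0,0,0], ![1,0,-l]), (![0,0,1], ![0,1,0]), (![0,0,1], ![1,0,0]),
        (![0,1,0], ![1,0,l])]
    let q : ℚ := (Fintype.card F : ℚ)
    let M : Matrix (Fin 7) (Fin 7) ℚ :=
      !![1, (q-1)*(q+1)^2, (q-1)*(q+1)^2*q/2, (q-1)^2*q*(q+1)/2, (q+1)^2*q*(q-1)^2,
           (q+1)^2*q^2*(q-1)^2/2, (q-1)^3*q^2*(q+1)/2;
         1, q^2-q-1, q*(2*q+1)*(q-1)/2, -(q*(q-1)/2), (q^2-q-1)*q*(q-1),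
           -(q^2*(q-1)*(q+1)/2), -(q^2*(q-1)^2/2);
         1, (2*q+1)*(q-1), q*(q^2-2*q-1)/2, q*(q-1)^2/2, -((q-1)*(q+1)*q),
           q^2*(q-1)^2/2, -(q^2*(q-1)^2/2);
         1, -q-1, (q-1)*(q+1)*q/2, (q^2+1)*q/2, -((q-1)*(q+1)*q),
           -(q^2*(q-1)*(q+1)/2), q^2*(q-1)*(q+1)/2;
         1, q^2-q-1, -((q+1)*q/2), -(q*(q-1)/2), q, -(q^2*(q-1)/2), q^2*(q-1)/2;
         1, -q-1, q*(q-1)/2, -(q*(q-1)/2), -(q*(q-1)), q^2, 0;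
         1, -q-1, -((q+1)*q/2), (q+1)*q/2, (q+1)*q, 0, -q^2]
    ∀ (i j : Fin 7) (y : (Fin 3 → F) × (Fin 3 → F)), InOrbitPB (r i) y →
      (Fintype.card F : ℂ) ^ 6 * FTPB p (fun x => if InOrbitPB (r j) x then 1 else 0) y
        = (M i j : ℂ) := by
  intro r q M i j y hy
  have h2 : (2 : F) ≠ 0 := Ring.two_ne_zero (ringChar.eq F p ▸ hp)
  have hr : ∀ j x, InOrbitPB (r j) x ↔ orbitClass j x := inOrbitPB_orbitRep_iff h2 hl
  obtain ⟨ψ, hψ, hpsi⟩ := exists_isPrimitive_psiF p F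
  rw [card_pow_mul_FTPB p hpsi]
  simp only [hr] at hy ⊢
  refine pairFT_orbitClass h2 hl hψ hy (fun j => (M i j : ℂ)) ?_ (fun t => ?_) (fun t => ?_) j
  · fin_cases i <;> simp [M]
  · fin_cases i <;> fin_cases t <;>
      simp [M, q, typeCount, orthoCount, Fin.sum_univ_three] <;> ring
  · fin_cases i <;> fin_cases t <;>
      simp [M, q, typeCount, orthoCount, Fin.sum_univ_three] <;> ring

end
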